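/- Let k > 0 and let ρ : (0, ∞) → (0, ∞) be continuously differentiable and strictly increasing with lim_{t→0⁺} ρ(t) = 0, and suppose there exist constants c > 0, α > 2 and T > 0 such that ρ(t) ≥ c·t^α for all t ≥ T. Then ∫_0^∞ t · ρ'(t) · ρ(t)^{−3/2} · e^{−k/ρ(t)} dt < ∞. In particular, taking k = (a−x)²/2, the first-passage time of the time-changed Brownian motion X(t) = x + B(ρ(t)) through the level a ≠ x, whose density is f_{τ₁}(t) = |a−x|·ρ(t)^{−3/2}·φ((a−x)/√(ρ(t)))·ρ'(t), has finite expectation. -/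

import Mathlib

open MeasureTheory

open Set Filter Topology

lemma rpow_neg_three_halves_mul_exp_le {k s : ℝ} (hk : 0 < k) (hs : 0 < s) :
    s ^ (-(3 : ℝ) / 2) * Real.exp (-k / s) ≤ 1 + 2 / k ^ 2 := by
  set u := s⁻¹ with hu
  have hu0 : 0 < u := inv_pos.mpr hs
  have h1 : s ^ (-(3 : ℝ) / 2) = u ^ ((3 : ℝ) / 2) := by
    rw [hu, Real.inv_rpow hs.le, ← Real.rpow_neg hs.le]
    norm_num [neg_div]
  have h2 : u ^ ((3 : ℝ) / 2) ≤ 1 + u ^ 2 := by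
    rcases le_total u 1 with h | h
    · have := Real.rpow_le_one hu0.le h (by norm_num : (0 : ℝ) ≤ 3 / 2)
      nlinarith [sq_nonneg u]
    · have := Real.rpow_le_rpow_of_exponent_le h (by norm_num : (3 : ℝ) / 2 ≤ 2)
      rw [Real.rpow_two] at this
      linarith
  have h3 : -k / s = -(k * u) := by rw [hu]; ring
  have h4 := Real.quadratic_le_exp_of_nonneg (mul_pos hk hu0).le
  rw [h1, h3, Real.exp_neg, ← div_eq_mul_inv, div_le_iff₀ (Real.exp_pos _)]
  have h5 : (1 + 2 / k ^ 2) * (1 + k * u + (k * u) ^ 2 / 2) =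
      1 + u ^ 2 + (2 / k ^ 2 + (1 + 2 / k ^ 2) * (k * u) + (k * u) ^ 2 / 2) := by
    field_simp
    ring
  have h6 : (1 + 2 / k ^ 2) * (1 + k * u + (k * u) ^ 2 / 2) ≤
      (1 + 2 / k ^ 2) * Real.exp (k * u) := by gcongr
  have h7 : 0 ≤ 2 / k ^ 2 + (1 + 2 / k ^ 2) * (k * u) + (k * u) ^ 2 / 2 := by positivity
  linarith

lemma StrictMonoOn.pos_of_tendsto_zero {ρ : ℝ → ℝ} (hmono : StrictMonoOn ρ (Ioi 0))
    (hlim : Tendsto ρ (𝓝[>] 0) (𝓝 0)) {t : ℝ} (ht : 0 < t) : 0 < ρ t := by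
  have h : 0 ≤ ρ (t / 2) := by
    refine le_of_tendsto hlim ?_
    filter_upwards [Ioo_mem_nhdsGT (half_pos ht)] with s hs
    exact (hmono hs.1 (half_pos ht) hs.2).le
  exact h.trans_lt (hmono (half_pos ht) ht (half_lt_self ht))

lemma StrictMonoOn.deriv_nonneg_of_mem_Ioi {ρ : ℝ → ℝ} (hmono : StrictMonoOn ρ (Ioi 0))
    {t : ℝ} (ht : 0 < t) : 0 ≤ deriv ρ t := by
  rw [← derivWithin_of_mem_nhds (Ioi_mem_nhds ht)]
  exact hmono.monotoneOn.derivWithin_nonneg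

/-- The derivative of an increasing function with a finite limit at `0⁺` is integrable near `0`. -/
lemma integrableOn_Ioc_deriv_of_tendsto {ρ : ℝ → ℝ} {T : ℝ}
    (hdiff : ∀ t ∈ Ioi (0 : ℝ), DifferentiableAt ℝ ρ t)
    (hnonneg : ∀ t ∈ Ioi (0 : ℝ), 0 ≤ deriv ρ t)
    (hlim : Tendsto ρ (𝓝[>] 0) (𝓝 0)) : IntegrableOn (deriv ρ) (Ioc 0 T) := by
  have heq : ∀ t : ℝ, 0 < t → Function.update ρ 0 0 =ᶠ[𝓝 t] ρ := fun t ht => by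
    filter_upwards [Ioi_mem_nhds ht] with s hs
    exact Function.update_of_ne (ne_of_gt hs) _ _
  refine intervalIntegral.integrableOn_deriv_of_nonneg (g := Function.update ρ 0 0) ?_
    (fun t ht => (hdiff t ht.1).hasDerivAt.congr_of_eventuallyEq (heq t ht.1))
    (fun t ht => hnonneg t ht.1)
  intro t ht
  rcases ht.1.eq_or_lt with rfl | h0
  · rw [continuousWithinAt_update_same]
    exact hlim.mono_left (nhdsWithin_mono _ fun s hs => lt_of_le_of_ne hs.1.1 (Ne.symm hs.2))
  · exact ((hdiff t h0).continuousAt.congr (heq t h0).symm).continuousWithinAt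

lemma integrableOn_Ioi_deriv_mul_rpow {ρ : ℝ → ℝ} {T δ : ℝ} (hδ : 0 < δ)
    (hdiff : ∀ t ∈ Ici T, DifferentiableAt ℝ ρ t) (hpos : ∀ t ∈ Ici T, 0 < ρ t)
    (hnonneg : ∀ t ∈ Ici T, 0 ≤ deriv ρ t) (htop : Tendsto ρ atTop atTop) :
    IntegrableOn (fun t => deriv ρ t * ρ t ^ (-δ - 1)) (Ioi T) := by
  have hd : ∀ t ∈ Ici T, HasDerivAt (fun t => -δ⁻¹ * ρ t ^ (-δ))
      (deriv ρ t * ρ t ^ (-δ - 1)) t := fun t ht => by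
    refine (((hdiff t ht).hasDerivAt.rpow_const (p := -δ)
      (Or.inl (hpos t ht).ne')).const_mul (-δ⁻¹)).congr_deriv ?_
    field_simp
  refine integrableOn_Ioi_deriv_of_nonneg' hd
    (fun t ht => mul_nonneg (hnonneg t (mem_Ici_of_Ioi ht))
      (Real.rpow_nonneg (hpos t (mem_Ici_of_Ioi ht)).le _))
    (((tendsto_rpow_neg_atTop hδ).comp htop).const_mul _)

/-- if `ρ` is a `C¹`, strictly increasing time change with `ρ(0⁺) = 0` and
`ρ(t) ≥ c t^α` eventually, with `α > 2`, then `∫_0^∞ t ρ'(t) ρ(t)^{-3/2} e^{-k/ρ(t)} dt < ∞`;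
in particular (with `k = (a-x)²/2`) the first-passage time of `X(t) = x + B(ρ(t))` through a
level `a ≠ x` has finite expectation. -/
theorem stmt_17 (k c α T : ℝ) (ρ : ℝ → ℝ)
    (hk : 0 < k) (hc : 0 < c) (hα : 2 < α) (hT : 0 < T)
    (hdiff : ∀ t ∈ Set.Ioi (0:ℝ), DifferentiableAt ℝ ρ t)
    (hderiv_cont : ContinuousOn (deriv ρ) (Set.Ioi 0))
    (hmono : StrictMonoOn ρ (Set.Ioi 0))
    (hlim : Filter.Tendsto ρ (nhdsWithin 0 (Set.Ioi 0)) (nhds 0))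
    (hgrow : ∀ t : ℝ, T ≤ t → c * t ^ α ≤ ρ t) :
    IntegrableOn
      (fun t : ℝ => t * deriv ρ t * ρ t ^ (-(3:ℝ) / 2) * Real.exp (-k / ρ t))
      (Set.Ioi 0) := by
  have hpos : ∀ t : ℝ, 0 < t → 0 < ρ t := fun t ht => hmono.pos_of_tendsto_zero hlim ht
  have hnn : ∀ t : ℝ, 0 < t → 0 ≤ deriv ρ t := fun t ht => hmono.deriv_nonneg_of_mem_Ioi ht
  have hcont : ContinuousOn
      (fun t : ℝ => t * deriv ρ t * ρ t ^ (-(3:ℝ) / 2) * Real.exp (-k / ρ t)) (Ioi 0) := by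
    have hρ : ContinuousOn ρ (Ioi 0) := fun t ht => (hdiff t ht).continuousAt.continuousWithinAt
    refine ((continuousOn_id.mul hderiv_cont).mul
      (hρ.rpow_const fun t ht => Or.inl (hpos t ht).ne')).mul ?_
    exact (continuousOn_const.div hρ fun t ht => (hpos t ht).ne').rexp
  have hsub : Ioi T ⊆ Ioi 0 := Ioi_subset_Ioi hT.le
  rw [← Ioc_union_Ioi_eq_Ioi hT.le]
  refine IntegrableOn.union ?_ ?_
  · refine Integrable.mono' ((integrableOn_Ioc_deriv_of_tendsto (T := T) hdiff hnn hlim).const_mul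
      (T * (1 + 2 / k ^ 2)))
      ((hcont.mono Ioc_subset_Ioi_self).aestronglyMeasurable measurableSet_Ioc) ?_
    filter_upwards [ae_restrict_mem measurableSet_Ioc] with t ht
    have h1 := hnn t ht.1
    have h2 := hpos t ht.1
    have h3 := ht.1.le
    rw [Real.norm_of_nonneg (by positivity)]
    calc _ = t * deriv ρ t * (ρ t ^ (-(3:ℝ) / 2) * Real.exp (-k / ρ t)) := by ring
      _ ≤ T * deriv ρ t * (1 + 2 / k ^ 2) := by
        gcongr
        · exact ht.2
        · exact rpow_neg_three_halves_mul_exp_le hk h2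
      _ = _ := by ring
  · have hα0 : 0 < α := by linarith
    have hδ : 0 < 1 / 2 - α⁻¹ := by
      have := (inv_lt_inv₀ hα0 (by norm_num : (0 : ℝ) < 2)).mpr hα
      linarith
    have htop : Tendsto ρ atTop atTop :=
      tendsto_atTop_mono' _ ((eventually_ge_atTop T).mono hgrow)
        ((tendsto_rpow_atTop hα0).const_mul_atTop hc)
    refine Integrable.mono' ((integrableOn_Ioi_deriv_mul_rpow (T := T) hδ
      (fun t ht => hdiff t (hT.trans_le ht)) (fun t ht => hpos t (hT.trans_le ht))
      (fun t ht => hnn t (hT.trans_le ht)) htop).const_mul (c⁻¹ ^ α⁻¹))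
      ((hcont.mono hsub).aestronglyMeasurable measurableSet_Ioi) ?_
    filter_upwards [ae_restrict_mem measurableSet_Ioi] with t ht
    have ht0 : 0 < t := hsub ht
    have h1 := hnn t ht0
    have h2 := hpos t ht0
    have h3 : t ≤ c⁻¹ ^ α⁻¹ * ρ t ^ α⁻¹ := by
      rw [← Real.mul_rpow (by positivity) h2.le,
        Real.le_rpow_inv_iff_of_pos ht0.le (by positivity) hα0, le_inv_mul_iff₀ hc]
      exact hgrow t (le_of_lt ht)
    have h4 : Real.exp (-k / ρ t) ≤ 1 :=
      Real.exp_le_one_iff.mpr (div_nonpos_of_nonpos_of_nonneg (by linarith) h2.le)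
    have h5 : ρ t ^ (-(1 / 2 - α⁻¹) - 1) = ρ t ^ α⁻¹ * ρ t ^ (-(3:ℝ) / 2) := by
      rw [← Real.rpow_add h2]
      ring_nf
    rw [Real.norm_of_nonneg (by positivity), h5]
    calc _ ≤ (c⁻¹ ^ α⁻¹ * ρ t ^ α⁻¹) * deriv ρ t * ρ t ^ (-(3:ℝ) / 2) * 1 := by gcongr
      _ = _ := by ring
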